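/- For every N ≥ 1 and d : Fin N → ℝ, with X_q = Σ_{j=1}^N d_j^{2q}, the torus moments satisfy I_4(d) = 24X_1⁴ − 72X_1²X_2 + 18X_2² + 64X_1X_3 − 33X_4, and I_5(d) = 120X_1⁵ − 600X_2X_1³ + 800X_3X_1² + 450X_2²X_1 − 825X_4X_1 − 400X_2X_3 + 456X_5. -/

import Mathlib

open MeasureTheory Real Filter Finset Nat

/-- The `m`-th torus moment of the weight vector `d`: the average of
`|Σ_j d_j e^{iθ_j}|^{2m}` over `N` independent angles uniform on `[0, 2π]`. -/
noncomputable def torusMoment (N : ℕ) (d : Fin N → ℝ) (m : ℕ) : ℝ :=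
  ((2 * π) ^ N)⁻¹ *
    ∫ θ : Fin N → ℝ in Set.univ.pi (fun _ => Set.Icc 0 (2 * π)),
      ‖∑ j, (d j : ℂ) * Complex.exp (Complex.I * (θ j : ℂ))‖ ^ (2 * m)

/-- `X_q = Σ_j d_j^{2q}`. -/
noncomputable def Xpow (N : ℕ) (d : Fin N → ℝ) (q : ℕ) : ℝ := ∑ j, d j ^ (2 * q)

/-- Orthogonality of the characters `θ ↦ e^{ikθ}` on a period. -/
theorem integral_exp_I_pow_mul_conj_pow (k l : ℕ) :
    ∫ t in (0 : ℝ)..(2 * π),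
        Complex.exp (Complex.I * t) ^ k * (starRingEnd ℂ (Complex.exp (Complex.I * t))) ^ l =
      if k = l then ((2 * π : ℝ) : ℂ) else 0 := by
  have hpt (t : ℝ) :
      Complex.exp (Complex.I * t) ^ k * (starRingEnd ℂ (Complex.exp (Complex.I * t))) ^ l =
        Complex.exp ((((k : ℂ) - l) * Complex.I) * t) := by
    rw [← Complex.exp_conj, ← Complex.exp_nat_mul, ← Complex.exp_nat_mul, ← Complex.exp_add]
    congr 1
    simp only [map_mul, Complex.conj_I, Complex.conj_ofReal]
    ring
  simp_rw [hpt]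
  split_ifs with h
  · simp [h]
  · have hne : ((k : ℂ) - l) * Complex.I ≠ 0 :=
      mul_ne_zero (sub_ne_zero.mpr (by exact_mod_cast h)) Complex.I_ne_zero
    rw [integral_exp_mul_complex hne]
    have hper : Complex.exp (((k : ℂ) - l) * Complex.I * ((2 * π : ℝ) : ℂ)) = 1 := by
      rw [Complex.exp_eq_one_iff]
      exact ⟨(k : ℤ) - l, by push_cast; ring⟩
    rw [hper]
    simp

/-- Parseval's identity for the polynomial `u ↦ (z + a u) ^ m` on the unit circle. -/
theorem integral_norm_add_mul_exp_pow (z : ℂ) (a : ℝ) (m : ℕ) :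
    ∫ t in (0 : ℝ)..(2 * π), ‖(a : ℂ) * Complex.exp (Complex.I * t) + z‖ ^ (2 * m) =
      2 * π * ∑ k ∈ range (m + 1), (m.choose k : ℝ) ^ 2 * a ^ (2 * k) * ‖z‖ ^ (2 * (m - k)) := by
  have hpt (t : ℝ) :
      ((‖(a : ℂ) * Complex.exp (Complex.I * t) + z‖ ^ (2 * m) : ℝ) : ℂ) =
        ∑ k ∈ range (m + 1), ∑ l ∈ range (m + 1),
          ((m.choose k * a ^ k * z ^ (m - k)) *
            (m.choose l * a ^ l * (starRingEnd ℂ z) ^ (m - l)) : ℂ) *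
          (Complex.exp (Complex.I * t) ^ k *
            (starRingEnd ℂ (Complex.exp (Complex.I * t))) ^ l) := by
    rw [pow_mul]
    push_cast
    rw [← Complex.mul_conj', mul_pow, ← map_pow, map_pow, map_add, map_mul, Complex.conj_ofReal,
      add_pow, add_pow, sum_mul_sum]
    refine sum_congr rfl fun k _ => sum_congr rfl fun l _ => ?_
    ring
  apply Complex.ofReal_injective
  rw [← intervalIntegral.integral_ofReal]
  simp_rw [hpt]
  rw [intervalIntegral.integral_finsetSum
    fun k _ => Continuous.intervalIntegrable (by fun_prop) _ _]
  push_cast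
  rw [mul_sum]
  refine sum_congr rfl fun k hk => ?_
  rw [intervalIntegral.integral_finsetSum
    fun l _ => Continuous.intervalIntegrable (by fun_prop) _ _]
  simp_rw [intervalIntegral.integral_const_mul, integral_exp_I_pow_mul_conj_pow]
  simp only [mul_ite, mul_zero, sum_ite_eq, if_pos hk]
  rw [pow_mul (‖z‖ : ℂ), ← Complex.mul_conj', mul_pow]
  push_cast
  ring

theorem integrable_norm_sum_exp_pow (N : ℕ) (d : Fin N → ℝ) (m : ℕ)
    (μ : Measure (Fin N → ℝ)) [IsFiniteMeasure μ] :
    Integrable (fun θ : Fin N → ℝ =>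
      ‖∑ j, (d j : ℂ) * Complex.exp (Complex.I * (θ j : ℂ))‖ ^ m) μ := by
  refine Integrable.of_bound (C := (∑ j, |d j|) ^ m)
    (Continuous.aestronglyMeasurable (by fun_prop)) (Eventually.of_forall fun θ => ?_)
  rw [norm_pow, norm_norm]
  gcongr
  refine (norm_sum_le _ _).trans (sum_le_sum fun j _ => ?_)
  simp [mul_comm Complex.I, Complex.norm_exp_ofReal_mul_I]

theorem torusMoment_eq_integral_pi (N : ℕ) (d : Fin N → ℝ) (m : ℕ) :
    torusMoment N d m = ((2 * π) ^ N)⁻¹ *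
      ∫ θ, ‖∑ j, (d j : ℂ) * Complex.exp (Complex.I * (θ j : ℂ))‖ ^ (2 * m)
        ∂(Measure.pi fun _ : Fin N => (volume : Measure ℝ).restrict (Set.Icc 0 (2 * π))) := by
  rw [torusMoment, volume_pi, Measure.restrict_pi_pi]

theorem torusMoment_zero (d : Fin 0 → ℝ) (m : ℕ) : torusMoment 0 d m = 0 ^ (2 * m) := by
  simp [torusMoment_eq_integral_pi, measureReal_def]

/-- Integrating out one angle. -/
theorem torusMoment_succ (N : ℕ) (d : Fin (N + 1) → ℝ) (m : ℕ) :
    torusMoment (N + 1) d m = ∑ k ∈ range (m + 1),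
      (m.choose k : ℝ) ^ 2 * d 0 ^ (2 * k) * torusMoment N (fun j => d j.succ) (m - k) := by
  have hmp := (measurePreserving_piFinSuccAbove
    (fun _ : Fin (N + 1) => (volume : Measure ℝ).restrict (Set.Icc 0 (2 * π))) 0).symm
  simp only [torusMoment_eq_integral_pi]
  rw [← hmp.integral_comp', integral_prod_symm]
  · have hinner (θ : Fin N → ℝ) :
        ∫ t in Set.Icc 0 (2 * π), ‖∑ j, (d j : ℂ) * Complex.exp (Complex.I *
          (((MeasurableEquiv.piFinSuccAbove (fun _ => ℝ) 0).symm (t, θ) j : ℝ) : ℂ))‖ ^ (2 * m) =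
        ∑ k ∈ range (m + 1), 2 * π * ((m.choose k : ℝ) ^ 2 * d 0 ^ (2 * k)) *
          ‖∑ j : Fin N, (d j.succ : ℂ) * Complex.exp (Complex.I * (θ j : ℂ))‖ ^ (2 * (m - k)) := by
      rw [integral_Icc_eq_integral_Ioc, ← intervalIntegral.integral_of_le (by positivity)]
      simp only [MeasurableEquiv.piFinSuccAbove_symm_apply, Fin.insertNthEquiv_zero,
        Fin.consEquiv_apply, Fin.sum_univ_succ, Fin.cons_zero, Fin.cons_succ]
      rw [integral_norm_add_mul_exp_pow, mul_sum]
      exact sum_congr rfl fun k _ => by ring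
    simp_rw [hinner]
    rw [integral_finsetSum _ fun k _ => (integrable_norm_sum_exp_pow N _ _ _).const_mul _, mul_sum]
    refine sum_congr rfl fun k _ => ?_
    rw [integral_const_mul, pow_succ]
    field_simp
  · exact hmp.integrable_comp_of_integrable (integrable_norm_sum_exp_pow (N + 1) d (2 * m) _)

theorem Xpow_succ (N : ℕ) (d : Fin (N + 1) → ℝ) (q : ℕ) :
    Xpow (N + 1) d q = d 0 ^ (2 * q) + Xpow N (fun j => d j.succ) q :=
  Fin.sum_univ_succ _

/-- The torus moments of order at most five. -/
theorem torusMoment_le_five (N : ℕ) (d : Fin N → ℝ) :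
    torusMoment N d 0 = 1 ∧
    torusMoment N d 1 = Xpow N d 1 ∧
    torusMoment N d 2 = 2 * Xpow N d 1 ^ 2 - Xpow N d 2 ∧
    torusMoment N d 3 = 6 * Xpow N d 1 ^ 3 - 9 * Xpow N d 1 * Xpow N d 2 + 4 * Xpow N d 3 ∧
    torusMoment N d 4 =
      24 * (Xpow N d 1) ^ 4 - 72 * (Xpow N d 1) ^ 2 * Xpow N d 2 + 18 * (Xpow N d 2) ^ 2
        + 64 * Xpow N d 1 * Xpow N d 3 - 33 * Xpow N d 4 ∧
    torusMoment N d 5 =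
      120 * (Xpow N d 1) ^ 5 - 600 * Xpow N d 2 * (Xpow N d 1) ^ 3
        + 800 * Xpow N d 3 * (Xpow N d 1) ^ 2 + 450 * (Xpow N d 2) ^ 2 * Xpow N d 1
        - 825 * Xpow N d 4 * Xpow N d 1 - 400 * Xpow N d 2 * Xpow N d 3
        + 456 * Xpow N d 5 := by
  induction N with
  | zero => simp [torusMoment_zero, Xpow]
  | succ N ih =>
    obtain ⟨h0, h1, h2, h3, h4, h5⟩ := ih fun j => d j.succ
    have c42 : Nat.choose 4 2 = 6 := rfl
    have c52 : Nat.choose 5 2 = 10 := rfl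
    have c53 : Nat.choose 5 3 = 10 := rfl
    refine ⟨?_, ?_, ?_, ?_, ?_, ?_⟩ <;>
    · simp [torusMoment_succ, sum_range_succ, Xpow_succ, h0, h1, h2, h3, h4, h5,
        c42, c52, c53]
      try ring

/-- The fourth and fifth torus moments:
`I₄ = 24X₁⁴ − 72X₁²X₂ + 18X₂² + 64X₁X₃ − 33X₄` and
`I₅ = 120X₁⁵ − 600X₂X₁³ + 800X₃X₁² + 450X₂²X₁ − 825X₄X₁ − 400X₂X₃ + 456X₅`. -/
theorem torusMoment_four_five (N : ℕ) (hN : 1 ≤ N) (d : Fin N → ℝ) :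
    torusMoment N d 4 =
      24 * (Xpow N d 1) ^ 4 - 72 * (Xpow N d 1) ^ 2 * Xpow N d 2 + 18 * (Xpow N d 2) ^ 2
        + 64 * Xpow N d 1 * Xpow N d 3 - 33 * Xpow N d 4 ∧
    torusMoment N d 5 =
      120 * (Xpow N d 1) ^ 5 - 600 * Xpow N d 2 * (Xpow N d 1) ^ 3
        + 800 * Xpow N d 3 * (Xpow N d 1) ^ 2 + 450 * (Xpow N d 2) ^ 2 * Xpow N d 1
        - 825 * Xpow N d 4 * Xpow N d 1 - 400 * Xpow N d 2 * Xpow N d 3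
        + 456 * Xpow N d 5 := by
  obtain ⟨-, -, -, -, h4, h5⟩ := torusMoment_le_five N d
  exact ⟨h4, h5⟩
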